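/- arXiv:2412.06103 — 2 statements merged into one kernel-verified Lean document; each statement's English description precedes it below -/
import Mathlib

section
/- For positive integers n ≥ k ≥ 1, the number of equivalence classes of k-tuples of positive integers summing to n under the dihedral group action (cyclic rotations and reversal) equals B(n,k) = (1/2)·N(n,k) + h(n,k), where N(n,k) = (1/k)·Σ_{d | gcd(n,k)} φ(d)·C(n/d−1, k/d−1) and h(n,k) is: (1/2)·C((n−1)/2, (k−1)/2) if n,k both odd; (1/2)·C(n/2−1, (k−1)/2) if n even, k odd; (1/2)·C((n−1)/2, k/2) if n odd, k even; (1/2)·C(n/2, k/2) if n,k both even. -/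
/-- Compositions of `n` into `k` positive parts. -/
abbrev Composition' (n k : ℕ) : Type :=
  {a : Fin k → ℕ // (∀ i, 0 < a i) ∧ ∑ i, a i = n}

/-- Dihedral equivalence (cyclic rotations and reversal) on compositions. -/
def DihedralRel (n k : ℕ) (a b : Composition' n k) : Prop :=
  ∃ r : Fin k, (∀ i, (b : Fin k → ℕ) i = (a : Fin k → ℕ) (i + r)) ∨
    (∀ i, (b : Fin k → ℕ) i = (a : Fin k → ℕ) (r - i))

/-- The quantity `2k·h(n,k)` from Sommerville's formula (so `h(n,k)` is half
the binomial coefficient below). -/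
def Hbin (n k : ℕ) : ℕ :=
  if n % 2 = 1 ∧ k % 2 = 1 then Nat.choose ((n - 1) / 2) ((k - 1) / 2)
  else if n % 2 = 0 ∧ k % 2 = 1 then Nat.choose (n / 2 - 1) ((k - 1) / 2)
  else if n % 2 = 1 ∧ k % 2 = 0 then Nat.choose ((n - 1) / 2) (k / 2)
  else Nat.choose (n / 2) (k / 2)

/-- Positive integer valued functions on `Q` with total mass `n`. -/
abbrev PosFun (Q : Type*) [Fintype Q] (n : ℕ) : Type _ :=
  {a : Q → ℕ // (∀ i, 0 < a i) ∧ ∑ i, a i = n}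

instance PosFun.instFinite (Q : Type*) [Fintype Q] (n : ℕ) : Finite (PosFun Q n) := by
  have : Finite {a : Q → ℕ // ∑ i, a i = n} := by
    classical
    exact Finite.of_equiv _ (Sym.equivNatSumOfFintype Q n)
  exact Finite.of_injective
    (fun a : PosFun Q n => (⟨a.1, a.2.2⟩ : {a : Q → ℕ // ∑ i, a i = n}))
    (fun a b h => Subtype.ext (congrArg (fun x => x.1) h))

theorem natCard_fun_sum_eq (Q : Type*) [Fintype Q] (n : ℕ) :
    Nat.card {a : Q → ℕ // ∑ i, a i = n} = (Fintype.card Q).multichoose n := by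
  classical
  rw [← Nat.card_congr (Sym.equivNatSumOfFintype Q n), Nat.card_eq_fintype_card,
    Sym.card_sym_eq_multichoose]

theorem natCard_posFun (Q : Type*) [Fintype Q] [Nonempty Q] {n : ℕ} (hn : 0 < n) :
    Nat.card (PosFun Q n) = (n - 1).choose (Fintype.card Q - 1) := by
  have hq : 0 < Fintype.card Q := Fintype.card_pos
  by_cases h : Fintype.card Q ≤ n
  · obtain ⟨N, rfl⟩ := Nat.exists_eq_add_of_le h
    let e : PosFun Q (Fintype.card Q + N) ≃ {a : Q → ℕ // ∑ i, a i = N} :=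
      { toFun a := ⟨fun i => a.1 i - 1, by
          have h1 : ∑ i, (a.1 i - 1) + ∑ _i : Q, 1 = ∑ i, a.1 i := by
            rw [← Finset.sum_add_distrib]
            exact Finset.sum_congr rfl fun i _ => Nat.sub_add_cancel (a.2.1 i)
          rw [a.2.2] at h1
          rw [← Fintype.card_eq_sum_ones] at h1
          exact Nat.add_right_cancel (h1.trans (add_comm _ _))⟩
        invFun c := ⟨fun i => c.1 i + 1, fun i => Nat.succ_pos _, by
          rw [Finset.sum_add_distrib, c.2]
          simp [add_comm]⟩
        left_inv a := by
          ext i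
          exact Nat.sub_add_cancel (a.2.1 i)
        right_inv c := by
          ext i
          simp }
    rw [Nat.card_congr e, natCard_fun_sum_eq, Nat.multichoose_eq]
    exact Nat.choose_symm_of_eq_add (by omega)
  · rw [Nat.choose_eq_zero_of_lt (by omega), Nat.card_eq_zero]
    left
    refine ⟨fun a => h ?_⟩
    have := Finset.sum_le_sum (s := Finset.univ) (f := fun _ => 1) fun i _ => a.2.1 i
    rw [a.2.2] at this
    simpa using this

/-- Positive functions on `F ⊕ M` whose values have weight `1` on `F` and weight `2` on `M`. -/
abbrev WeightedPosFun (F M : Type*) [Fintype F] [Fintype M] (n : ℕ) : Type _ :=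
  {p : (F → ℕ) × (M → ℕ) //
    (∀ i, 0 < p.1 i) ∧ (∀ i, 0 < p.2 i) ∧ ∑ i, p.1 i + 2 * ∑ i, p.2 i = n}

/-- Write each value on `F` as `2 c + e + 1` with `e ∈ {0, 1}` and each value on `M` as `c + 1`. -/
def weightedPosFunEquiv (F M : Type*) [Fintype F] [Fintype M] (n : ℕ) :
    WeightedPosFun F M n ≃ Σ e : F → Fin 2, {c : F ⊕ M → ℕ //
      2 * ∑ i, c i + ∑ i, (e i : ℕ) + Fintype.card F + 2 * Fintype.card M = n} where
  toFun p := ⟨fun i => ⟨(p.1.1 i - 1) % 2, Nat.mod_lt _ two_pos⟩,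
    Sum.elim (fun i => (p.1.1 i - 1) / 2) (fun i => p.1.2 i - 1), by
      obtain ⟨⟨x, y⟩, hx, hy, h⟩ := p
      simp only at hx hy h ⊢
      have h1 : ∑ i, x i = 2 * ∑ i, (x i - 1) / 2 + ∑ i, (x i - 1) % 2 + Fintype.card F := by
        rw [Fintype.card_eq_sum_ones, Finset.mul_sum, ← Finset.sum_add_distrib,
          ← Finset.sum_add_distrib]
        refine Finset.sum_congr rfl fun i _ => ?_
        have := hx i
        omega
      have h2 : ∑ i, y i = ∑ i, (y i - 1) + Fintype.card M := by
        rw [Fintype.card_eq_sum_ones, ← Finset.sum_add_distrib]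
        refine Finset.sum_congr rfl fun i _ => ?_
        have := hy i
        omega
      rw [Fintype.sum_sum_type]
      simp only [Sum.elim_inl, Sum.elim_inr]
      omega⟩
  invFun q := ⟨(fun i => 2 * q.2.1 (Sum.inl i) + q.1 i + 1, fun i => q.2.1 (Sum.inr i) + 1),
    fun i => Nat.succ_pos _, fun i => Nat.succ_pos _, by
      obtain ⟨e, c, h⟩ := q
      rw [Fintype.sum_sum_type] at h
      simp only [Finset.sum_add_distrib, ← Finset.mul_sum, ← Fintype.card_eq_sum_ones]
      omega⟩
  left_inv p := by
    obtain ⟨⟨x, y⟩, hx, hy, h⟩ := p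
    simp only at hx hy
    refine Subtype.ext (Prod.ext (funext fun i => ?_) (funext fun i => ?_))
    · have := hx i
      simp only [Sum.elim_inl]
      omega
    · have := hy i
      simp only [Sum.elim_inr]
      omega
  right_inv q := by
    obtain ⟨e, c, h⟩ := q
    have he : (fun i => ⟨(2 * c (Sum.inl i) + e i + 1 - 1) % 2, Nat.mod_lt _ two_pos⟩) = e := by
      funext i
      ext
      have := (e i).2
      simp only
      omega
    refine Sigma.subtype_ext he (funext fun i => ?_)
    rcases i with i | i
    · have := (e i).2
      simp only [Sum.elim_inl]
      omega
    · simp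

/-- The number of functions `c` on a `q`-element set with `2 ∑ c + s = n`. -/
def evenMassCount (q s n : ℕ) : ℕ :=
  if s ≤ n ∧ n % 2 = s % 2 then q.multichoose ((n - s) / 2) else 0

theorem natCard_two_mul_sum_add_eq (Q : Type*) [Fintype Q] (s n : ℕ) :
    Nat.card {c : Q → ℕ // 2 * ∑ i, c i + s = n} = evenMassCount (Fintype.card Q) s n := by
  unfold evenMassCount
  split_ifs with h
  · rw [← natCard_fun_sum_eq]
    exact Nat.card_congr (Equiv.subtypeEquivRight fun c => by omega)
  · rw [Nat.card_eq_zero]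
    left
    exact ⟨fun c => by have := c.2; omega⟩

theorem natCard_weightedPosFun (F M : Type*) [Fintype F] [Fintype M] (n : ℕ) :
    Nat.card (WeightedPosFun F M n) = ∑ e : Fin (Fintype.card F) → Fin 2,
      evenMassCount (Fintype.card F + Fintype.card M)
        (∑ i, (e i : ℕ) + Fintype.card F + 2 * Fintype.card M) n := by
  have key (e : F → Fin 2) : Nat.card {c : F ⊕ M → ℕ //
      2 * ∑ i, c i + ∑ i, (e i : ℕ) + Fintype.card F + 2 * Fintype.card M = n} =
      evenMassCount (Fintype.card F + Fintype.card M)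
        (∑ i, (e i : ℕ) + Fintype.card F + 2 * Fintype.card M) n := by
    rw [← Fintype.card_sum, ← natCard_two_mul_sum_add_eq]
    simp only [add_assoc]
  have (e : F → Fin 2) : Finite {c : F ⊕ M → ℕ //
      2 * ∑ i, c i + ∑ i, (e i : ℕ) + Fintype.card F + 2 * Fintype.card M = n} := by
    refine Set.Finite.to_subtype 
      ((Set.Finite.pi' fun _ => Set.finite_Iic n).subset fun c hc i => ?_)
    have := Finset.single_le_sum (f := c) (fun i _ => Nat.zero_le _) (Finset.mem_univ i)
    have hc' : 2 * ∑ i, c i + ∑ i, (e i : ℕ) + Fintype.card F + 2 * Fintype.card M = n := hc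
    rw [Set.mem_Iic]
    omega
  classical
  rw [Nat.card_congr (weightedPosFunEquiv F M n), Nat.card_sigma]
  simp only [key]
  refine Fintype.sum_equiv (Equiv.arrowCongr (Fintype.equivFin F) (Equiv.refl _)) _ _ fun e => ?_
  congr 3
  exact Fintype.sum_equiv (Fintype.equivFin F) _ _ fun i => by simp

/-- Functions invariant under an involution are determined by their values on the fixed points
and on one point from each orbit of size two. -/
theorem natCard_involutive_invariant {X : Type*} [Fintype X] [LinearOrder X] {σ : X → X}
    (hσ : Function.Involutive σ) (n : ℕ) :
    Nat.card {a : PosFun X n // ∀ j, a.1 (σ j) = a.1 j} =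
      Nat.card (WeightedPosFun {j // σ j = j} {j // j < σ j} n) ∧
    Fintype.card X = Fintype.card {j // σ j = j} + 2 * Fintype.card {j // j < σ j} := by
  have hsum (a : X → ℕ) (ha : ∀ j, a (σ j) = a j) :
      ∑ j, a j = ∑ j : {j // σ j = j}, a j + 2 * ∑ j : {j // j < σ j}, a j := by
    have h3 : ∑ j with σ j < j, a j = ∑ j with j < σ j, a j :=
      Finset.sum_bij' (fun j _ => σ j) (fun j _ => σ j)
        (by simp [hσ _]) (by simp [hσ _]) (by simp [hσ _]) (by simp [hσ _]) (by simp [ha])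
    rw [← Finset.sum_subtype_eq_sum_filter, ← Finset.sum_subtype_eq_sum_filter] at h3
    have h4 : ∑ j, a j =
        ∑ j with σ j = j, a j + (∑ j with j < σ j, a j + ∑ j with σ j < j, a j) := by
      simp only [Finset.sum_filter, ← Finset.sum_add_distrib]
      refine Finset.sum_congr rfl fun j _ => ?_
      rcases lt_trichotomy (σ j) j with h | h | h
      · simp [h, h.ne, h.not_gt]
      · simp [h]
      · simp [h, h.ne', h.not_gt]
    rw [← Finset.sum_subtype_eq_sum_filter, ← Finset.sum_subtype_eq_sum_filter,
      ← Finset.sum_subtype_eq_sum_filter] at h4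
    simp only [Finset.subtype_univ] at h3 h4
    rw [h4, h3, two_mul]
  refine ⟨Nat.card_congr
    { toFun a := ⟨(fun j => a.1.1 j, fun j => a.1.1 j), fun j => a.1.2.1 _, fun j => a.1.2.1 _, by
        rw [← hsum _ a.2]; exact a.1.2.2⟩
      invFun p :=
        let b : X → ℕ := fun j => if h : σ j = j then p.1.1 ⟨j, h⟩ else
          if h' : j < σ j then p.1.2 ⟨j, h'⟩ else
            p.1.2 ⟨σ j, by rw [hσ]; exact lt_of_le_of_ne (not_lt.1 h') h⟩
        have hb : ∀ j, b (σ j) = b j := fun j => by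
          rcases lt_trichotomy (σ j) j with h | h | h
          · simp [b, h, h.ne, h.not_gt, hσ j, h.ne']
          · simp [b, h]
          · simp [b, h, h.ne', h.not_gt, hσ j, h.ne]
        ⟨⟨b, fun j => by
          simp only [b]
          split_ifs
          · exact p.2.1 _
          · exact p.2.2.1 _
          · exact p.2.2.1 _, by
          rw [hsum b hb, ← p.2.2.2]
          congr 1
          · exact Finset.sum_congr rfl fun j _ => by simp [b, j.2]
          · congr 1
            exact Finset.sum_congr rfl fun j _ => by simp [b, j.2, j.2.ne']⟩, hb⟩
      left_inv a := by
        ext j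
        simp only
        split_ifs
        · rfl
        · rfl
        · exact a.2 j
      right_inv p := by
        refine Subtype.ext (Prod.ext (funext fun j => ?_) (funext fun j => ?_))
        · simp [j.2]
        · simp [j.2, j.2.ne'] }, ?_⟩
  simpa using hsum (fun _ => 1) fun _ => rfl

/-- The number of positive functions with total weighted mass `n`, where `f` arguments have weight
`1` and `m` arguments have weight `2`. -/
def weightedCount (f m n : ℕ) : ℕ :=
  ∑ e : Fin f → Fin 2, evenMassCount (f + m) (∑ i, (e i : ℕ) + f + 2 * m) n

theorem weightedCount_zero (m n : ℕ) : weightedCount 0 m n = evenMassCount m (2 * m) n := by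
  simp [weightedCount]

theorem weightedCount_one (m n : ℕ) : weightedCount 1 m n =
    evenMassCount (m + 1) (2 * m + 1) n + evenMassCount (m + 1) (2 * m + 2) n := by
  rw [weightedCount, Fintype.sum_equiv (Equiv.funUnique (Fin 1) (Fin 2)) _
    fun x => evenMassCount (m + 1) (2 * m + 1 + x) n]
  · simp [Fin.sum_univ_two]
  · intro e
    simp only [Fin.sum_univ_one, Equiv.funUnique_apply, Fin.default_eq_zero]
    congr 1 <;> ring

theorem weightedCount_two (m n : ℕ) : weightedCount 2 m n =
    evenMassCount (m + 2) (2 * m + 2) n + 2 * evenMassCount (m + 2) (2 * m + 3) n +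
      evenMassCount (m + 2) (2 * m + 4) n := by
  rw [weightedCount, Fintype.sum_equiv (piFinTwoEquiv fun _ => Fin 2) _
    fun x => evenMassCount (m + 2) (2 * m + 2 + x.1 + x.2) n]
  · simp [Fintype.sum_prod_type, Fin.sum_univ_two]
    ring
  · intro e
    simp only [Fin.sum_univ_two, piFinTwoEquiv_apply]
    congr 1 <;> ring

theorem evenMassCount_succ {q s n N : ℕ} (h : n = s + 2 * N) :
    evenMassCount (q + 1) s n = (q + N).choose q := by
  rw [evenMassCount, if_pos (by omega), Nat.multichoose_eq, show (n - s) / 2 = N by omega,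
    show q + 1 + N - 1 = q + N by omega]
  exact (Nat.choose_symm_add (a := q) (b := N)).symm

theorem evenMassCount_of_odd {q s n : ℕ} (h : n % 2 ≠ s % 2) : evenMassCount q s n = 0 :=
  if_neg fun h' => h h'.2

theorem evenMassCount_of_lt {q s n : ℕ} (h : n < s) : evenMassCount q s n = 0 :=
  if_neg fun h' => h.not_ge h'.1

theorem weightedCount_one_eq_hbin {m n : ℕ} (h : 2 * m + 1 ≤ n) :
    weightedCount 1 m n = Hbin n (2 * m + 1) := by
  rw [weightedCount_one, Hbin]
  rcases Nat.even_or_odd' n with ⟨N, rfl | rfl⟩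
  · rw [evenMassCount_of_odd (by omega), evenMassCount_succ (N := N - m - 1) (by omega),
      if_neg (by omega), if_pos (by omega), zero_add]
    congr 1 <;> omega
  · rw [evenMassCount_of_odd (s := 2 * m + 2) (by omega),
      evenMassCount_succ (N := N - m) (by omega), if_pos (by omega), add_zero]
    congr 1 <;> omega

theorem weightedCount_two_add_zero_eq_hbin {m n : ℕ} (h : 2 * m + 2 ≤ n) :
    weightedCount 2 m n + weightedCount 0 (m + 1) n = 2 * Hbin n (2 * m + 2) := by
  rw [weightedCount_two, weightedCount_zero, Hbin, if_neg (by omega), if_neg (by omega),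
    show (2 * m + 2) / 2 = m + 1 by omega]
  rcases Nat.even_or_odd' n with ⟨N, rfl | rfl⟩
  · obtain ⟨M, rfl⟩ := Nat.exists_eq_add_of_le (show m + 1 ≤ N by omega)
    rw [evenMassCount_of_odd (s := 2 * m + 3) (by omega), evenMassCount_succ (s := 2 * m + 2) (N := M) (by omega),
      evenMassCount_succ (s := 2 * (m + 1)) (N := M) (by omega), if_neg (by omega),
      show 2 * (m + 1 + M) / 2 = m + M + 1 by omega, show 2 * (m + 1 + M) = 2 * (m + M + 1) by omega,
      show m + 1 + M = m + M + 1 by omega]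
    have h4 : evenMassCount (m + 2) (2 * m + 4) (2 * (m + M + 1)) = (m + M).choose (m + 1) := by
      rcases M with _ | M
      · rw [evenMassCount_of_lt (by omega), Nat.choose_eq_zero_of_lt (by omega)]
      · rw [evenMassCount_succ (N := M) (by omega)]
        congr 1
        omega
    rw [h4, Nat.choose_succ_succ]
    ring
  · rw [evenMassCount_of_odd (s := 2 * m + 2) (by omega),
      evenMassCount_of_odd (s := 2 * m + 4) (by omega),
      evenMassCount_of_odd (s := 2 * (m + 1)) (by omega),
      evenMassCount_succ (N := N - m - 1) (by omega), if_pos (by omega), zero_add, add_zero,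
      add_zero]
    congr 2
    omega

section ZModAction

variable (k : ℕ) [NeZero k]

theorem card_neg_sub_eq_self_le_two (i : ZMod k) : Fintype.card {j : ZMod k // -j - i = j} ≤ 2 := by
  rcases isEmpty_or_nonempty {j : ZMod k // -j - i = j} with h | ⟨⟨x, hx⟩⟩
  · simp
  · refine le_trans ?_ (IsAddCyclic.card_nsmul_eq_zero_le (α := ZMod k) two_pos)
    rw [Fintype.card_subtype]
    refine Finset.card_le_card_of_injOn (fun j => j - x) (fun j hj => ?_) fun a _ b _ h => ?_
    · simp only [Finset.coe_filter, Finset.mem_univ, true_and, Set.mem_ofPred_eq, two_nsmul] at hj ⊢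
      linear_combination hx - hj
    · simpa using h

theorem sum_card_neg_sub_eq_self :
    ∑ i : ZMod k, Fintype.card {j : ZMod k // -j - i = j} = k := by
  simp only [Fintype.card_subtype, Finset.card_filter]
  rw [Finset.sum_comm]
  have (i j : ZMod k) : -j - i = j ↔ i = -j - j := by
    constructor <;> intro h <;> linear_combination -h
  simp [this, ZMod.card]

theorem natCard_reflection_invariant (n : ℕ) (i : ZMod k) :
    ∃ m, Fintype.card {j : ZMod k // -j - i = j} + 2 * m = k ∧
      Nat.card {a : PosFun (ZMod k) n // ∀ j, a.1 (-j - i) = a.1 j} =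
        weightedCount (Fintype.card {j : ZMod k // -j - i = j}) m n := by
  let : LinearOrder (ZMod k) := LinearOrder.lift' (ZMod.val) (ZMod.val_injective k)
  have := natCard_involutive_invariant (σ := fun j : ZMod k => -j - i) (fun j => by simp) n
  refine ⟨Fintype.card {j : ZMod k // j < -j - i}, ?_, ?_⟩
  · have h := this.2
    rw [ZMod.card] at h
    convert h.symm
  · rw [this.1, natCard_weightedPosFun]
    exact congrArg₂ (fun f m => weightedCount f m n)
      (@Fintype.card_congr _ _ (_) (_) (Equiv.refl _)) rfl

theorem sum_natCard_reflection_invariant {n : ℕ} (hkn : k ≤ n) :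
    ∑ i : ZMod k, Nat.card {a : PosFun (ZMod k) n // ∀ j, a.1 (-j - i) = a.1 j} = k * Hbin n k := by
  have hk : k ≠ 0 := NeZero.ne k
  rcases Nat.even_or_odd' k with ⟨h, hh | hh⟩
  · obtain ⟨m, rfl⟩ := Nat.exists_eq_succ_of_ne_zero (show h ≠ 0 by omega)
    have key (i : ZMod k) :
        2 * Nat.card {a : PosFun (ZMod k) n // ∀ j, a.1 (-j - i) = a.1 j} +
          Fintype.card {j : ZMod k // -j - i = j} * weightedCount 0 (m + 1) n =
        2 * weightedCount 0 (m + 1) n +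
          Fintype.card {j : ZMod k // -j - i = j} * weightedCount 2 m n := by
      obtain ⟨l, hl, h⟩ := natCard_reflection_invariant k n i
      have h2 := card_neg_sub_eq_self_le_two k i
      rw [h]
      generalize Fintype.card {j : ZMod k // -j - i = j} = f at *
      obtain ⟨rfl, rfl⟩ | ⟨rfl, rfl⟩ : (f = 0 ∧ l = m + 1) ∨ (f = 2 ∧ l = m) := by omega
      · ring
      · ring
    have hs := Finset.sum_congr (rfl : (Finset.univ : Finset (ZMod k)) = _) fun i _ => key i
    simp only [Finset.sum_add_distrib, ← Finset.mul_sum, ← Finset.sum_mul,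
      sum_card_neg_sub_eq_self, Finset.sum_const, Finset.card_univ, ZMod.card, smul_eq_mul] at hs
    have hw := weightedCount_two_add_zero_eq_hbin (m := m) (n := n) (by omega)
    rw [show 2 * m + 2 = k by omega] at hw
    have hw' := congrArg (k * ·) hw
    linarith
  · have key (i : ZMod k) :
        Nat.card {a : PosFun (ZMod k) n // ∀ j, a.1 (-j - i) = a.1 j} = Hbin n k := by
      obtain ⟨l, hl, hc⟩ := natCard_reflection_invariant k n i
      have h2 := card_neg_sub_eq_self_le_two k i
      rw [hc]
      generalize Fintype.card {j : ZMod k // -j - i = j} = f at *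
      obtain ⟨rfl, rfl⟩ : f = 1 ∧ l = h := by omega
      rw [weightedCount_one_eq_hbin (by omega), ← hh]
    simp [key, ZMod.card]

theorem natCard_translation_invariant {G : Type*} [AddCommGroup G] [Fintype G] {n : ℕ} (hn : 0 < n)
    (i : G) : Nat.card {a : PosFun G n // ∀ j, a.1 (j - i) = a.1 j} =
      if addOrderOf i ∣ n then
        (n / addOrderOf i - 1).choose (Fintype.card G / addOrderOf i - 1) else 0 := by
  classical
  let H := AddSubgroup.zmultiples i
  have hd : Nat.card H = addOrderOf i := Nat.card_zmultiples i
  have hpos : 0 < addOrderOf i := addOrderOf_pos i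
  have hq : Fintype.card (G ⧸ H) = Fintype.card G / addOrderOf i := by
    have := AddSubgroup.card_eq_card_quotient_mul_card_addSubgroup H
    rw [hd, Nat.card_eq_fintype_card, Nat.card_eq_fintype_card] at this
    rw [this, Nat.mul_div_cancel _ hpos]
  have hsum (b : G ⧸ H → ℕ) : ∑ j : G, b j = addOrderOf i * ∑ q, b q := by
    rw [Finset.mul_sum, ← Finset.sum_fiberwise (g := fun j : G => (j : G ⧸ H))]
    refine Finset.sum_congr rfl fun q _ => ?_
    rw [Finset.sum_congr rfl (g := fun _ => b q) fun j hj => by rw [(Finset.mem_filter.1 hj).2],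
      Finset.sum_const, smul_eq_mul, ← hd, ← Fintype.card_subtype, ← Nat.card_eq_fintype_card]
    congr 1
    have := Nat.card_congr (QuotientAddGroup.preimageMkEquivAddSubgroupProdSet H {q})
    rw [Nat.card_prod, Nat.card_unique (α := ({q} : Set (G ⧸ H))), mul_one] at this
    exact this
  let e : {a : PosFun G n // ∀ j, a.1 (j - i) = a.1 j} ≃
      {b : G ⧸ H → ℕ // (∀ q, 0 < b q) ∧ addOrderOf i * ∑ q, b q = n} :=
    { toFun a :=
        let b : G ⧸ H → ℕ := fun q => Quotient.liftOn' q a.1.1 fun x y hxy => by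
          rw [QuotientAddGroup.leftRel_apply] at hxy
          obtain ⟨z, hz⟩ := AddSubgroup.mem_zmultiples_iff.1 hxy
          have hper : Function.Periodic a.1.1 i := fun x => by
            rw [← a.2 (x + i), add_sub_cancel_right]
          rw [← hper.zsmul z x, hz, add_neg_cancel_left]
        ⟨b, fun q => Quotient.inductionOn' q a.1.2.1, by
          rw [← hsum]; exact a.1.2.2⟩
      invFun b := ⟨⟨fun j => b.1 j, fun j => b.2.1 _, by rw [hsum, b.2.2]⟩, fun j => by
        refine congrArg b.1 (QuotientAddGroup.eq.2 ?_)
        simp [H]⟩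
      left_inv a := rfl
      right_inv b := by
        refine Subtype.ext (funext fun q => ?_)
        exact Quotient.inductionOn' q fun _ => rfl }
  rw [Nat.card_congr e]
  split_ifs with h
  · obtain ⟨N, rfl⟩ := h
    rw [Nat.mul_div_cancel_left _ hpos, ← hq, ← natCard_posFun _ (Nat.pos_of_mul_pos_left hn)]
    exact Nat.card_congr (Equiv.subtypeEquivRight fun b => by
      rw [Nat.mul_right_inj hpos.ne'])
  · rw [Nat.card_eq_zero]
    left
    exact ⟨fun b => h ⟨_, b.2.2.symm⟩⟩

theorem sum_natCard_rotation_invariant {n : ℕ} (hn : 0 < n) :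
    ∑ i : ZMod k, Nat.card {a : PosFun (ZMod k) n // ∀ j, a.1 (j - i) = a.1 j} =
      ∑ d ∈ (Nat.gcd n k).divisors,
        Nat.totient d * Nat.choose (n / d - 1) (k / d - 1) := by
  have hk : k ≠ 0 := NeZero.ne k
  simp only [natCard_translation_invariant hn, ZMod.card]
  rw [← Finset.sum_filter, ← Finset.sum_fiberwise_of_maps_to (t := (Nat.gcd n k).divisors)
    (g := fun i : ZMod k => addOrderOf i)]
  · refine Finset.sum_congr rfl fun d hd => ?_
    have hd' := Nat.dvd_of_mem_divisors hd
    rw [Finset.filter_filter, Finset.sum_congr rfl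
      (g := fun _ => (n / d - 1).choose (k / d - 1)) fun i hi => by
        rw [(Finset.mem_filter.1 hi).2.2], Finset.sum_const, smul_eq_mul]
    congr 1
    rw [← IsAddCyclic.card_addOrderOf_eq_totient (α := ZMod k) (d := d)
      (by rw [ZMod.card]; exact hd'.trans (Nat.gcd_dvd_right n k))]
    congr 1
    ext i
    simp only [Finset.mem_filter, Finset.mem_univ, true_and, and_iff_right_iff_imp]
    rintro rfl
    exact hd'.trans (Nat.gcd_dvd_left n k)
  · intro i hi
    rw [Nat.mem_divisors]
    refine ⟨Nat.dvd_gcd (Finset.mem_filter.1 hi).2 ?_, Nat.gcd_ne_zero_right hk⟩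
    simpa [ZMod.card] using addOrderOf_dvd_card (x := i)

/-- The dihedral group acts on functions on `ZMod k` by rotating and reflecting the argument. -/
instance PosFun.instMulAction (n : ℕ) : MulAction (DihedralGroup k) (PosFun (ZMod k) n) where
  smul g a := match g with
    | .r i => ⟨fun j => a.1 (j - i), fun j => a.2.1 _, by
        exact (Fintype.sum_equiv (Equiv.subRight i) _ a.1 fun _ => rfl).trans a.2.2⟩
    | .sr i => ⟨fun j => a.1 (-j - i), fun j => a.2.1 _, by
        exact (Fintype.sum_equiv ((Equiv.neg _).trans (Equiv.subRight i)) _ a.1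
          fun _ => rfl).trans a.2.2⟩
  one_smul a := Subtype.ext (funext fun j => congrArg a.1 (sub_zero j))
  mul_smul := by
    rintro (i | i) (j | j) a <;> refine Subtype.ext (funext fun x => congrArg a.1 ?_) <;>
      ring

theorem dihedral_burnside (n : ℕ) :
    2 * k * Nat.card (MulAction.orbitRel.Quotient (DihedralGroup k) (PosFun (ZMod k) n)) =
      ∑ i : ZMod k, Nat.card {a : PosFun (ZMod k) n // ∀ j, a.1 (j - i) = a.1 j} +
        ∑ i : ZMod k, Nat.card {a : PosFun (ZMod k) n // ∀ j, a.1 (-j - i) = a.1 j} := by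
  classical
  let := Fintype.ofFinite (PosFun (ZMod k) n)
  let := Fintype.ofFinite (MulAction.orbitRel.Quotient (DihedralGroup k) (PosFun (ZMod k) n))
  have h := MulAction.sum_card_fixedBy_eq_card_orbits_mul_card_group (DihedralGroup k)
    (PosFun (ZMod k) n)
  rw [DihedralGroup.card, mul_comm, ← Nat.card_eq_fintype_card] at h
  refine h.symm.trans ?_
  rw [Fintype.sum_equiv DihedralGroup.equivSum _ (fun s => Fintype.card
    (MulAction.fixedBy (PosFun (ZMod k) n) (DihedralGroup.equivSum.symm s)))
      (fun g => by simp only [Equiv.symm_apply_apply]),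
    Fintype.sum_sum_type]
  congr 1 <;> refine Finset.sum_congr rfl fun i _ => ?_ <;> rw [← Nat.card_eq_fintype_card] <;>
    exact Nat.card_congr (Equiv.subtypeEquivRight fun a => Subtype.ext_iff.trans funext_iff)

end ZModAction

theorem dihedralRel_iff_orbitRel (n m : ℕ) (a b : PosFun (ZMod (m + 1)) n) :
    DihedralRel n (m + 1) a b ↔
      MulAction.orbitRel (DihedralGroup (m + 1)) (PosFun (ZMod (m + 1)) n) b a := by
  rw [MulAction.orbitRel_apply]
  constructor
  · rintro ⟨r, h | h⟩
    · refine ⟨.r (-r : ZMod (m + 1)), Subtype.ext (funext fun j => ?_)⟩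
      refine Eq.trans (congrArg a.1 ?_) (h j).symm
      exact sub_neg_eq_add (α := ZMod (m + 1)) j r
    · refine ⟨.sr (-r : ZMod (m + 1)), Subtype.ext (funext fun j => ?_)⟩
      refine Eq.trans (congrArg a.1 ?_) (h j).symm
      exact neg_sub_neg (α := ZMod (m + 1)) j r
  · rintro ⟨i | i, rfl⟩
    · exact ⟨(-i : ZMod (m + 1)), .inl fun j =>
        congrArg a.1 (sub_eq_add_neg (G := ZMod (m + 1)) j i)⟩
    · refine ⟨(-i : ZMod (m + 1)), .inr fun j => congrArg a.1 ?_⟩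
      exact neg_sub_comm (α := ZMod (m + 1)) j i

/-- The number of bracelets `B(n,k)` (dihedral classes of compositions of `n`
into `k` positive parts) satisfies `B(n,k) = (1/2)N(n,k) + h(n,k)`, i.e.
`2k·B(n,k) = ∑_{d ∣ gcd(n,k)} φ(d) C(n/d-1,k/d-1) + k·(2 h(n,k))`. -/
theorem bracelet_count (n k : ℕ) (hk : 1 ≤ k) (hkn : k ≤ n) :
    2 * k * Nat.card (Quot (DihedralRel n k)) =
      (∑ d ∈ (Nat.gcd n k).divisors,
        Nat.totient d * Nat.choose (n / d - 1) (k / d - 1)) + k * Hbin n k := by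
  have : NeZero k := ⟨by omega⟩
  rw [← sum_natCard_rotation_invariant k (by omega), ← sum_natCard_reflection_invariant k hkn,
    ← dihedral_burnside]
  obtain ⟨m, rfl⟩ := Nat.exists_eq_add_of_le' hk
  congr 1
  exact Nat.card_congr (Quot.congr (Equiv.refl (PosFun (ZMod (m + 1)) n)) fun a b =>
    (dihedralRel_iff_orbitRel n m a b).trans 
      ⟨(MulAction.orbitRel _ _).symm', (MulAction.orbitRel _ _).symm'⟩)
end

section
/- For positive integers n₁,k₁,n₂,k₂ with n₁ ≥ k₁, n₂ ≥ k₂, and k = k₁ + k₂, the number of necklaces (cyclic equivalence classes) of k-tuples with k₁ entries that are positive integers summing to n₁ and k₂ entries that are negative integers whose absolute values sum to n₂ equals (1/k)·Σ_{d | gcd(k₁,k₂,n₁,n₂)} φ(d)·C(k/d, k₁/d)·C(n₁/d − 1, k₁/d − 1)·C(n₂/d − 1, k₂/d − 1). -/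
/-- Two-colored compositions: `(k₁+k₂)`-tuples of nonzero integers whose `k₁`
positive entries sum to `n₁` and whose `k₂` negative entries have absolute
values summing to `n₂`. -/
abbrev TwoColorComposition (n₁ k₁ n₂ k₂ : ℕ) : Type :=
  {a : Fin (k₁ + k₂) → ℤ //
    (∀ i, a i ≠ 0) ∧
    (Finset.univ.filter fun i => 0 < a i).card = k₁ ∧
    (∑ i ∈ Finset.univ.filter fun i => 0 < a i, a i) = (n₁ : ℤ) ∧
    (Finset.univ.filter fun i => a i < 0).card = k₂ ∧
    (∑ i ∈ Finset.univ.filter fun i => a i < 0, |a i|) = (n₂ : ℤ)}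

/-- Cyclic rotation equivalence on two-colored compositions. -/
def TwoColorCyclicRel (n₁ k₁ n₂ k₂ : ℕ)
    (a b : TwoColorComposition n₁ k₁ n₂ k₂) : Prop :=
  ∃ r : Fin (k₁ + k₂), ∀ i,
    (b : Fin (k₁ + k₂) → ℤ) i = (a : Fin (k₁ + k₂) → ℤ) (i + r)

namespace TwoColorNecklace

open Finset

section Count

variable {ι : Type*} [DecidableEq ι]

/-- Families of natural numbers with support exactly `s` and sum `n`. -/
def posAntidiag (s : Finset ι) (n : ℕ) : Finset (ι →₀ ℕ) :=
  {f ∈ s.finsuppAntidiag n | f.support = s}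

lemma mem_posAntidiag {s : Finset ι} {n : ℕ} {f : ι →₀ ℕ} :
    f ∈ posAntidiag s n ↔ ∑ i ∈ s, f i = n ∧ f.support = s := by
  simp only [posAntidiag, mem_filter, mem_finsuppAntidiag]
  exact ⟨fun h => ⟨h.1.1, h.2⟩, fun h => ⟨⟨h.1, h.2.le⟩, h.2⟩⟩

lemma card_le_of_mem_posAntidiag {s : Finset ι} {n : ℕ} {f : ι →₀ ℕ}
    (hf : f ∈ posAntidiag s n) : #s ≤ n := by
  rw [mem_posAntidiag] at hf
  rw [← hf.1, card_eq_sum_ones]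
  refine sum_le_sum fun i hi => ?_
  rw [← hf.2, Finsupp.mem_support_iff] at hi
  omega

lemma card_posAntidiag {s : Finset ι} {n : ℕ} (hs : s.Nonempty) (hn : 0 < n) :
    #(posAntidiag s n) = (n - 1).choose (#s - 1) := by
  have hs' := hs.card_pos
  rcases lt_or_ge n #s with h | h
  · rw [Nat.choose_eq_zero_of_lt (by omega), card_eq_zero, eq_empty_iff_forall_notMem]
    exact fun f hf => h.not_ge (card_le_of_mem_posAntidiag hf)
  · have key : #(posAntidiag s n) = #(s.finsuppAntidiag (n - #s)) := by
      set e : ι →₀ ℕ := Finsupp.indicator s (fun _ _ => 1) with he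
      have hes : ∀ i ∈ s, e i = 1 := fun i hi => by simp [he, hi]
      have hes' : ∀ i ∉ s, e i = 0 := fun i hi => by simp [he, hi]
      have hsum : ∑ i ∈ s, e i = #s := by rw [sum_congr rfl hes, card_eq_sum_ones]
      refine card_nbij' (fun f => f - e) (fun f => f + e) ?_ ?_ ?_ ?_
      · intro f hf
        have hf := mem_posAntidiag.1 hf
        have h1 : ∀ i ∈ s, e i ≤ f i := fun i hi => by
          rw [hes i hi]
          rw [← hf.2, Finsupp.mem_support_iff] at hi
          omega
        refine mem_finsuppAntidiag.2 ⟨?_, fun i hi => ?_⟩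
        · simp only [Finsupp.coe_tsub, Pi.sub_apply]
          rw [sum_tsub_distrib _ h1, hf.1, hsum]
        · rw [← hf.2]
          simp only [Finsupp.mem_support_iff, Finsupp.tsub_apply] at hi ⊢
          omega
      · intro f hf
        have hf := mem_finsuppAntidiag.1 hf
        refine mem_posAntidiag.2 ⟨?_, ?_⟩
        · simp only [Finsupp.add_apply, sum_add_distrib]
          rw [hf.1, hsum]
          omega
        · ext i
          by_cases hi : i ∈ s
          · simp [hi, hes i hi]
          · have : f i = 0 := Finsupp.notMem_support_iff.1 fun h => hi (hf.2 h)
            simp [hi, hes' i hi, this]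
      · intro f hf
        have hf := mem_posAntidiag.1 hf
        ext i
        by_cases hi : i ∈ s
        · have h1 := hes i hi
          rw [← hf.2, Finsupp.mem_support_iff] at hi
          simp only [Finsupp.add_apply, Finsupp.tsub_apply]
          omega
        · simp [hes' i hi]
      · intro f _
        simp
    rw [key, card_finsuppAntidiag_nat_eq_choose]
    have : #s + (n - #s) - 1 = n - 1 := by omega
    rw [this, ← Nat.choose_symm (by omega)]
    congr 1
    omega

end Count

section Tuples

variable {ι κ : Type*} [Fintype ι] [Fintype κ]

/-- Two-colored compositions with parts indexed by an arbitrary finite type. -/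
def tuples (ι : Type*) [Fintype ι] (n₁ k₁ n₂ k₂ : ℕ) : Set (ι → ℤ) :=
  {a | (∀ i, a i ≠ 0) ∧
    (univ.filter fun i => 0 < a i).card = k₁ ∧
    (∑ i ∈ univ.filter fun i => 0 < a i, a i) = (n₁ : ℤ) ∧
    (univ.filter fun i => a i < 0).card = k₂ ∧
    (∑ i ∈ univ.filter fun i => a i < 0, |a i|) = (n₂ : ℤ)}

lemma mem_and_or_notMem_and_of_support_eq [DecidableEq ι] {s : Finset ι} {f g : ι →₀ ℕ}
    (hf : f.support = s) (hg : g.support = sᶜ) (i : ι) :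
    (i ∈ s ∧ f i ≠ 0 ∧ g i = 0) ∨ (i ∉ s ∧ f i = 0 ∧ g i ≠ 0) := by
  have hfi : i ∈ s ↔ f i ≠ 0 := by rw [← hf, Finsupp.mem_support_iff]
  have hgi : i ∉ s ↔ g i ≠ 0 := by rw [← mem_compl, ← hg, Finsupp.mem_support_iff]
  tauto

lemma filter_pos_eq_of_support_eq [DecidableEq ι] {s : Finset ι} {f g : ι →₀ ℕ}
    (hf : f.support = s) (hg : g.support = sᶜ) :
    (univ.filter fun i => 0 < (f i : ℤ) - g i) = s := by
  ext i
  have := mem_and_or_notMem_and_of_support_eq hf hg i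
  simp only [mem_filter, mem_univ, true_and]
  grind

/-- A two-colored composition is determined by its set of positive positions, its positive part and
its negative part. -/
noncomputable def tuplesEquiv [DecidableEq ι] {n₁ k₁ n₂ k₂ : ℕ}
    (hk : Fintype.card ι = k₁ + k₂) :
    tuples ι n₁ k₁ n₂ k₂ ≃ ((powersetCard k₁ (univ : Finset ι)).sigma
      fun s => posAntidiag s n₁ ×ˢ posAntidiag sᶜ n₂) where
  toFun a := ⟨⟨univ.filter fun i => 0 < a.1 i,
    Finsupp.equivFunOnFinite.symm fun i => (a.1 i).toNat,
    Finsupp.equivFunOnFinite.symm fun i => (-a.1 i).toNat⟩, by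
      obtain ⟨a, h0, h1, h2, h3, h4⟩ := a
      have hc : (univ.filter fun i => 0 < a i)ᶜ = univ.filter fun i => a i < 0 := by
        ext i
        have := h0 i
        simp only [mem_compl, mem_filter, mem_univ, true_and]
        omega
      simp only [mem_sigma, mem_powersetCard_univ, mem_product, mem_posAntidiag,
        Finsupp.equivFunOnFinite_symm_apply_apply, hc]
      refine ⟨h1, ⟨?_, ?_⟩, ?_, ?_⟩
      · zify
        rw [← h2]
        refine sum_congr rfl fun i hi => ?_
        simp only [mem_filter, mem_univ, true_and] at hi
        omega
      · ext i
        simp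
      · zify
        rw [← h4]
        refine sum_congr rfl fun i hi => ?_
        simp only [mem_filter, mem_univ, true_and] at hi
        rw [abs_of_neg hi]
        omega
      · ext i
        simp⟩
  invFun x := ⟨fun i => (x.1.2.1 i : ℤ) - x.1.2.2 i, by
      obtain ⟨⟨s, f, g⟩, h⟩ := x
      simp only [mem_sigma, mem_powersetCard_univ, mem_product, mem_posAntidiag] at h
      obtain ⟨hs, ⟨hf, hfs⟩, hg, hgs⟩ := h
      have h0 := mem_and_or_notMem_and_of_support_eq hfs hgs
      have hp := filter_pos_eq_of_support_eq hfs hgs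
      have hn : (univ.filter fun i => (f i : ℤ) - g i < 0) = sᶜ := by
        ext i
        simp only [mem_filter, mem_univ, true_and, mem_compl]
        grind
      simp only [tuples, Set.mem_ofPred_eq, hp, hn]
      refine ⟨fun i => ?_, hs, ?_, ?_, ?_⟩
      · have := h0 i
        omega
      · rw [← hf]
        push_cast
        refine sum_congr rfl fun i hi => ?_
        have : g i = 0 := by grind
        simp [this]
      · rw [card_compl, hs, hk]
        omega
      · rw [← hg]
        push_cast
        refine sum_congr rfl fun i hi => ?_
        have : f i = 0 := by grind
        simp [this]⟩
  left_inv a := by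
    ext i
    simp only [Finsupp.equivFunOnFinite_symm_apply_apply]
    omega
  right_inv x := by
    obtain ⟨⟨s, f, g⟩, h⟩ := x
    simp only [mem_sigma, mem_powersetCard_univ, mem_product, mem_posAntidiag] at h
    obtain ⟨hs, ⟨hf, hfs⟩, hg, hgs⟩ := h
    have h0 := mem_and_or_notMem_and_of_support_eq hfs hgs
    have e1 := filter_pos_eq_of_support_eq hfs hgs
    have e2 : (Finsupp.equivFunOnFinite.symm fun i => ((f i : ℤ) - g i).toNat) = f := by
      ext i
      rw [Finsupp.equivFunOnFinite_symm_apply_apply]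
      have := h0 i
      omega
    have e3 : (Finsupp.equivFunOnFinite.symm fun i => (-((f i : ℤ) - g i)).toNat) = g := by
      ext i
      rw [Finsupp.equivFunOnFinite_symm_apply_apply]
      have := h0 i
      omega
    simp only [e1, e2, e3]

lemma finite_tuples {n₁ k₁ n₂ k₂ : ℕ} (hk : Fintype.card ι = k₁ + k₂) :
    Finite (tuples ι n₁ k₁ n₂ k₂) := by
  classical
  exact Finite.of_equiv _ (tuplesEquiv hk).symm

lemma card_tuples {n₁ k₁ n₂ k₂ : ℕ} (hk : Fintype.card ι = k₁ + k₂)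
    (hk₁ : 0 < k₁) (hk₂ : 0 < k₂) (hn₁ : 0 < n₁) (hn₂ : 0 < n₂) :
    Nat.card (tuples ι n₁ k₁ n₂ k₂) =
      (k₁ + k₂).choose k₁ * (n₁ - 1).choose (k₁ - 1) * (n₂ - 1).choose (k₂ - 1) := by
  classical
  rw [Nat.card_congr (tuplesEquiv hk), Nat.card_eq_fintype_card, Fintype.card_coe, card_sigma]
  have : ∀ s ∈ powersetCard k₁ (univ : Finset ι), #(posAntidiag s n₁ ×ˢ posAntidiag sᶜ n₂) =
      (n₁ - 1).choose (k₁ - 1) * (n₂ - 1).choose (k₂ - 1) := fun s hs => by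
    have hs := mem_powersetCard_univ.1 hs
    have hs' : #sᶜ = k₂ := by rw [card_compl, hs, hk]; omega
    rw [card_product, card_posAntidiag (card_pos.1 (by omega)) hn₁,
      card_posAntidiag (card_pos.1 (by omega)) hn₂, hs, hs']
  rw [sum_congr rfl this, sum_const, card_powersetCard, card_univ, hk, smul_eq_mul, mul_assoc]

variable {f : ι → κ} {d : ℕ}

lemma sum_comp_of_card_fiber [DecidableEq κ] {M : Type*} [AddCommMonoid M]
    (hf : ∀ j, #{i | f i = j} = d) (F : κ → M) : ∑ i, F (f i) = d • ∑ j, F j := by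
  rw [← sum_fiberwise univ f, smul_sum]
  refine sum_congr rfl fun j _ => ?_
  rw [sum_congr rfl (g := fun _ => F j) (by simp +contextual), sum_const, hf]

lemma comp_mem_tuples_iff [DecidableEq κ] (hd : d ≠ 0) (hf : ∀ j, #{i | f i = j} = d)
    {a : κ → ℤ} {n₁ k₁ n₂ k₂ : ℕ} :
    a ∘ f ∈ tuples ι n₁ k₁ n₂ k₂ ↔ (∀ j, a j ≠ 0) ∧
      d * #{j | 0 < a j} = k₁ ∧
      (d * ∑ j with 0 < a j, a j) = (n₁ : ℤ) ∧
      d * #{j | a j < 0} = k₂ ∧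
      (d * ∑ j with a j < 0, |a j|) = (n₂ : ℤ) := by
  have hsurj : Function.Surjective f := fun j => by
    obtain ⟨i, hi⟩ := card_pos.1 (by rw [hf j]; omega : 0 < #{i | f i = j})
    exact ⟨i, (mem_filter.1 hi).2⟩
  simp only [tuples, Set.mem_ofPred_eq, Function.comp_apply, card_filter, sum_filter]
  rw [hsurj.forall (p := fun j => a j ≠ 0),
    sum_comp_of_card_fiber hf (fun j => if 0 < a j then 1 else 0),
    sum_comp_of_card_fiber hf (fun j => if 0 < a j then a j else 0),
    sum_comp_of_card_fiber hf (fun j => if a j < 0 then 1 else 0),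
    sum_comp_of_card_fiber hf (fun j => if a j < 0 then |a j| else 0)]
  simp only [nsmul_eq_mul, Nat.cast_id]

lemma comp_mem_tuples_mul_iff [DecidableEq κ] (hd : d ≠ 0) (hf : ∀ j, #{i | f i = j} = d)
    {a : κ → ℤ} {n₁ k₁ n₂ k₂ : ℕ} :
    a ∘ f ∈ tuples ι (d * n₁) (d * k₁) (d * n₂) (d * k₂) ↔ a ∈ tuples κ n₁ k₁ n₂ k₂ := by
  rw [comp_mem_tuples_iff hd hf]
  have : (d : ℤ) ≠ 0 := by exact_mod_cast hd
  simp only [tuples, Set.mem_ofPred_eq, Nat.cast_mul, mul_right_inj' hd, mul_right_inj' this]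

lemma dvd_of_comp_mem_tuples [DecidableEq κ] (hd : d ≠ 0) (hf : ∀ j, #{i | f i = j} = d)
    {a : κ → ℤ} {n₁ k₁ n₂ k₂ : ℕ} (h : a ∘ f ∈ tuples ι n₁ k₁ n₂ k₂) :
    d ∣ (k₁.gcd k₂).gcd (n₁.gcd n₂) := by
  obtain ⟨-, h1, h2, h3, h4⟩ := (comp_mem_tuples_iff hd hf).1 h
  exact Nat.dvd_gcd (Nat.dvd_gcd ⟨_, h1.symm⟩ ⟨_, h3.symm⟩)
    (Nat.dvd_gcd (Int.natCast_dvd_natCast.1 ⟨_, h2.symm⟩) (Int.natCast_dvd_natCast.1 ⟨_, h4.symm⟩))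

lemma comp_equiv_mem_tuples_iff (e : ι ≃ κ) {a : κ → ℤ} {n₁ k₁ n₂ k₂ : ℕ} :
    a ∘ e ∈ tuples ι n₁ k₁ n₂ k₂ ↔ a ∈ tuples κ n₁ k₁ n₂ k₂ := by
  classical
  have hf : ∀ j, #{i | e i = j} = 1 := fun j =>
    card_eq_one.2 ⟨e.symm j, by ext i; simp [Equiv.eq_symm_apply]⟩
  simpa using comp_mem_tuples_mul_iff one_ne_zero hf (a := a)

end Tuples

section Burnside

variable {G : Type*} [AddCommGroup G] [Fintype G] {n₁ k₁ n₂ k₂ : ℕ}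

instance : AddAction G (tuples G n₁ k₁ n₂ k₂) where
  vadd r a := ⟨a.1 ∘ Equiv.addRight r, (comp_equiv_mem_tuples_iff _).2 a.2⟩
  zero_vadd a := Subtype.ext <| funext fun i => congrArg a.1 (add_zero i)
  add_vadd r s a := Subtype.ext <| funext fun i => congrArg a.1 (by
    simp only [Equiv.coe_addRight]
    abel)

lemma vadd_apply (r : G) (a : tuples G n₁ k₁ n₂ k₂) (i : G) : (r +ᵥ a).1 i = a.1 (i + r) := rfl

lemma card_fiber_mk [DecidableEq G] (H : AddSubgroup G) [DecidableEq (G ⧸ H)] (q : G ⧸ H) :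
    #{i : G | (i : G ⧸ H) = q} = Nat.card H := by
  have := Nat.card_congr (QuotientAddGroup.preimageMkEquivAddSubgroupProdSet H {q})
  rw [Nat.card_prod, Nat.card_unique (α := ({q} : Set (G ⧸ H))), mul_one] at this
  rw [← this, ← Nat.subtype_card _ (p := fun i : G => (i : G ⧸ H) = q) (by simp)]
  rfl

lemma eq_comp_mk_of_mem_fixedBy {r : G} {a : tuples G n₁ k₁ n₂ k₂}
    (ha : a ∈ AddAction.fixedBy (tuples G n₁ k₁ n₂ k₂) r) :
    ∃ b : G ⧸ AddSubgroup.zmultiples r → ℤ, b ∘ QuotientAddGroup.mk = a.1 := by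
  refine ⟨Quotient.lift a.1 fun i j hij => ?_, rfl⟩
  obtain ⟨m, hm⟩ := AddSubgroup.mem_zmultiples_iff.1
    (QuotientAddGroup.leftRel_apply.1 hij)
  have : m • r +ᵥ a = a := AddAction.mem_stabilizer_iff.1
    (zsmul_mem (AddAction.mem_stabilizer_iff.2 ha) m)
  have h := congrArg (fun x => x.1 i) this
  simp only [vadd_apply, hm, add_neg_cancel_left] at h
  exact h.symm

lemma card_fixedBy_of_not_dvd (r : G) (h : ¬ addOrderOf r ∣ (k₁.gcd k₂).gcd (n₁.gcd n₂)) :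
    Nat.card (AddAction.fixedBy (tuples G n₁ k₁ n₂ k₂) r) = 0 := by
  classical
  rw [Nat.card_eq_zero]
  refine .inl ⟨fun ⟨a, ha⟩ => h ?_⟩
  obtain ⟨b, hb⟩ := eq_comp_mk_of_mem_fixedBy ha
  refine dvd_of_comp_mem_tuples (addOrderOf_pos r).ne' (fun q => ?_) (hb ▸ a.2)
  rw [card_fiber_mk, Nat.card_zmultiples]

lemma card_fixedBy_mul {r : G} {d : ℕ} (hr : addOrderOf r = d) :
    Nat.card (AddAction.fixedBy (tuples G (d * n₁) (d * k₁) (d * n₂) (d * k₂)) r) =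
      Nat.card (tuples (G ⧸ AddSubgroup.zmultiples r) n₁ k₁ n₂ k₂) := by
  classical
  have hd : d ≠ 0 := hr ▸ (addOrderOf_pos r).ne'
  have hf : ∀ q : G ⧸ AddSubgroup.zmultiples r, #{i : G | (i : G ⧸ _) = q} = d := fun q => by
    rw [card_fiber_mk, Nat.card_zmultiples, hr]
  let F (b : tuples (G ⧸ AddSubgroup.zmultiples r) n₁ k₁ n₂ k₂) :
      AddAction.fixedBy (tuples G (d * n₁) (d * k₁) (d * n₂) (d * k₂)) r :=
    ⟨⟨b.1 ∘ QuotientAddGroup.mk, (comp_mem_tuples_mul_iff hd hf).2 b.2⟩,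
      Subtype.ext <| funext fun i => congrArg b.1 (by simp)⟩
  refine (Nat.card_congr (Equiv.ofBijective F ⟨fun b c h => ?_, fun ⟨a, ha⟩ => ?_⟩)).symm
  · refine Subtype.ext <| funext fun q => ?_
    induction q using QuotientAddGroup.induction_on with | H i =>
    exact congrFun (congrArg (fun x => x.1.1) h) i
  · obtain ⟨b, hb⟩ := eq_comp_mk_of_mem_fixedBy ha
    exact ⟨⟨b, (comp_mem_tuples_mul_iff hd hf).1 (hb ▸ a.2)⟩, Subtype.ext (Subtype.ext hb)⟩

lemma card_fixedBy_of_dvd (hG : Fintype.card G = k₁ + k₂)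
    (hk₁ : 0 < k₁) (hk₂ : 0 < k₂) (hn₁ : 0 < n₁) (hn₂ : 0 < n₂) {r : G} {d : ℕ}
    (hr : addOrderOf r = d) (h : d ∣ (k₁.gcd k₂).gcd (n₁.gcd n₂)) :
    Nat.card (AddAction.fixedBy (tuples G n₁ k₁ n₂ k₂) r) =
      ((k₁ + k₂) / d).choose (k₁ / d) * (n₁ / d - 1).choose (k₁ / d - 1) *
        (n₂ / d - 1).choose (k₂ / d - 1) := by
  classical
  obtain ⟨⟨⟨k₁, rfl⟩, k₂, rfl⟩, ⟨n₁, rfl⟩, n₂, rfl⟩ :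
      (d ∣ k₁ ∧ d ∣ k₂) ∧ d ∣ n₁ ∧ d ∣ n₂ := by
    simpa only [Nat.dvd_gcd_iff] using h
  have hd : 0 < d := hr ▸ addOrderOf_pos r
  rw [← mul_add] at hG ⊢
  have hq : Fintype.card (G ⧸ AddSubgroup.zmultiples r) = k₁ + k₂ := by
    have := AddSubgroup.card_eq_card_quotient_mul_card_addSubgroup (AddSubgroup.zmultiples r)
    rw [Nat.card_zmultiples, hr, Nat.card_eq_fintype_card, Nat.card_eq_fintype_card, hG,
      mul_comm] at this
    exact (Nat.eq_of_mul_eq_mul_right hd this).symm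
  simp only [Nat.mul_div_cancel_left _ hd]
  rw [card_fixedBy_mul hr]
  exact card_tuples hq (pos_of_mul_pos_right hk₁ hd.le) (pos_of_mul_pos_right hk₂ hd.le)
    (pos_of_mul_pos_right hn₁ hd.le) (pos_of_mul_pos_right hn₂ hd.le)

lemma card_orbits [IsAddCyclic G] (hG : Fintype.card G = k₁ + k₂)
    (hk₁ : 0 < k₁) (hk₂ : 0 < k₂) (hn₁ : 0 < n₁) (hn₂ : 0 < n₂) :
    (k₁ + k₂) * Nat.card (AddAction.orbitRel.Quotient G (tuples G n₁ k₁ n₂ k₂)) =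
      ∑ d ∈ ((k₁.gcd k₂).gcd (n₁.gcd n₂)).divisors,
        d.totient * ((k₁ + k₂) / d).choose (k₁ / d) *
          (n₁ / d - 1).choose (k₁ / d - 1) * (n₂ / d - 1).choose (k₂ / d - 1) := by
  classical
  set g := (k₁.gcd k₂).gcd (n₁.gcd n₂)
  have hg0 : g ≠ 0 := (Nat.gcd_pos_of_pos_left _ (Nat.gcd_pos_of_pos_left _ hk₁)).ne'
  have hgk : g ∣ k₁ + k₂ := by
    have := Nat.gcd_dvd_left (k₁.gcd k₂) (n₁.gcd n₂)
    exact dvd_add (this.trans (Nat.gcd_dvd_left _ _)) (this.trans (Nat.gcd_dvd_right _ _))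
  have := finite_tuples (n₁ := n₁) (n₂ := n₂) hG
  have := Fintype.ofFinite (tuples G n₁ k₁ n₂ k₂)
  have burnside :=
    AddAction.sum_card_fixedBy_eq_card_orbits_mul_card_addGroup G (tuples G n₁ k₁ n₂ k₂)
  rw [hG, mul_comm] at burnside
  rw [Nat.card_eq_fintype_card, ← burnside]
  simp only [← Nat.card_eq_fintype_card]
  have hsub : ∑ r : G with addOrderOf r ∣ g,
      Nat.card (AddAction.fixedBy (tuples G n₁ k₁ n₂ k₂) r) =
      ∑ r : G, Nat.card (AddAction.fixedBy (tuples G n₁ k₁ n₂ k₂) r) := by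
    refine sum_subset (filter_subset _ _) fun r _ hr => card_fixedBy_of_not_dvd r ?_
    simpa using hr
  rw [← hsub, ← sum_fiberwise_of_maps_to (t := g.divisors) (g := addOrderOf) (by simp [hg0])]
  refine sum_congr rfl fun d hd => ?_
  have hd := Nat.dvd_of_mem_divisors hd
  have hfil : {r ∈ ({r | addOrderOf r ∣ g} : Finset G) | addOrderOf r = d} =
      ({r | addOrderOf r = d} : Finset G) := by
    ext r
    simp only [mem_filter, mem_univ, true_and, and_iff_right_iff_imp]
    exact fun h => h ▸ hd
  rw [hfil, sum_congr rfl fun r hr =>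
    card_fixedBy_of_dvd hG hk₁ hk₂ hn₁ hn₂ (mem_filter.1 hr).2 hd, sum_const, smul_eq_mul,
    IsAddCyclic.card_addOrderOf_eq_totient (hG ▸ hd.trans hgk)]
  simp only [mul_assoc]

end Burnside

open Fin.CommRing in
lemma isAddCyclic_fin (n : ℕ) [NeZero n] : IsAddCyclic (Fin n) :=
  ⟨1, fun x => AddSubgroup.mem_zmultiples_iff.2 ⟨x.val, by
    rw [natCast_zsmul]
    exact (nsmul_one x.val).trans (Fin.cast_val_eq_self x)⟩⟩

end TwoColorNecklace

/-- The number of two-colored necklaces with parameters `(n₁,k₁;n₂,k₂)` equals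
`(1/k) ∑_{d ∣ gcd(k₁,k₂,n₁,n₂)} φ(d) C(k/d,k₁/d) C(n₁/d-1,k₁/d-1) C(n₂/d-1,k₂/d-1)`,
where `k = k₁ + k₂`. -/
theorem two_color_necklace_count (n₁ k₁ n₂ k₂ : ℕ)
    (hk₁ : 0 < k₁) (hk₂ : 0 < k₂) (h₁ : k₁ ≤ n₁) (h₂ : k₂ ≤ n₂) :
    (k₁ + k₂) * Nat.card (Quot (TwoColorCyclicRel n₁ k₁ n₂ k₂)) =
      ∑ d ∈ (Nat.gcd (Nat.gcd k₁ k₂) (Nat.gcd n₁ n₂)).divisors,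
        Nat.totient d * Nat.choose ((k₁ + k₂) / d) (k₁ / d) *
          Nat.choose (n₁ / d - 1) (k₁ / d - 1) *
          Nat.choose (n₂ / d - 1) (k₂ / d - 1) := by
  have : NeZero (k₁ + k₂) := ⟨by omega⟩
  have := TwoColorNecklace.isAddCyclic_fin (k₁ + k₂)
  rw [← TwoColorNecklace.card_orbits (G := Fin (k₁ + k₂)) (Fintype.card_fin _) hk₁ hk₂
    (hk₁.trans_le h₁) (hk₂.trans_le h₂)]
  congr 1
  refine Nat.card_congr (Quot.congrRight fun a b => ?_)
  refine Iff.trans ?_ (Setoid.comm' (AddAction.orbitRel (Fin (k₁ + k₂))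
    (TwoColorNecklace.tuples (Fin (k₁ + k₂)) n₁ k₁ n₂ k₂)))
  exact exists_congr fun r => ⟨fun h => Subtype.ext (funext fun i => (h i).symm),
    fun h i => (congrFun (congrArg Subtype.val h) i).symm⟩
end
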